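/- Let X be a real Banach space. Assume there is a locally convex topology τ on X* (a topology making X* a locally convex topological vector space over ℝ) such that Ienv(A) equals the τ-closure of conv(A) for every A ⊆ X*. Then a linear functional φ : X* → ℝ is τ-continuous if and only if there exists x** ∈ B₁(X) with φ(ξ) = x**(ξ) for all ξ ∈ X*. -/

import Mathlib

open Filter Topology

noncomputable section

/-- The weak* topology on the dual of `E`: pointwise convergence on `E`. -/
def wstarTop (E : Type*) [NormedAddCommGroup E] [NormedSpace ℝ E] :
    TopologicalSpace (E →L[ℝ] ℝ) :=
  TopologicalSpace.induced (fun f (x : E) => f x) Pi.topologicalSpace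

/-- Weak* closure of a set of functionals. -/
def wstarClosure {E : Type*} [NormedAddCommGroup E] [NormedSpace ℝ E]
    (A : Set (E →L[ℝ] ℝ)) : Set (E →L[ℝ] ℝ) :=
  @closure _ (wstarTop E) A

/-- The (I)-envelope of a set in a dual Banach space. -/
def Ienv {E : Type*} [NormedAddCommGroup E] [NormedSpace ℝ E]
    (A : Set (E →L[ℝ] ℝ)) : Set (E →L[ℝ] ℝ) :=
  ⋂ (As : ℕ → Set (E →L[ℝ] ℝ)) (_ : A = ⋃ n, As n),
    closure (convexHull ℝ (⋃ n, wstarClosure (convexHull ℝ (As n))))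

/-- `B₁(E)`: elements of the bidual that are weak* limits of sequences from `E`. -/
def B1 (E : Type*) [NormedAddCommGroup E] [NormedSpace ℝ E] :
    Set ((E →L[ℝ] ℝ) →L[ℝ] ℝ) :=
  {F | ∃ x : ℕ → E, ∀ ξ : E →L[ℝ] ℝ,
    Tendsto (fun n => ξ (x n)) atTop (𝓝 (F ξ))}

/-- `C(E)`: elements of the bidual lying in the weak* closure of a countable subset of `E`. -/
def CX (E : Type*) [NormedAddCommGroup E] [NormedSpace ℝ E] :
    Set ((E →L[ℝ] ℝ) →L[ℝ] ℝ) :=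
  {F | ∃ C : Set E, C.Countable ∧
    F ∈ wstarClosure ((fun x => NormedSpace.inclusionInDoubleDual ℝ E x) '' C)}

/-- The topology `σ(E*, Y)` for a set `Y` of elements of the bidual. -/
def sigmaTop {E : Type*} [NormedAddCommGroup E] [NormedSpace ℝ E]
    (Y : Set ((E →L[ℝ] ℝ) →L[ℝ] ℝ)) : TopologicalSpace (E →L[ℝ] ℝ) :=
  TopologicalSpace.induced
    (fun f (y : Y) => (y : (E →L[ℝ] ℝ) →L[ℝ] ℝ) f) Pi.topologicalSpace

end

theorem aux_convexJoin {E : Type*} [AddCommGroup E] [Module ℝ E] [TopologicalSpace E]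
    [IsTopologicalAddGroup E] [ContinuousSMul ℝ E] {s t : Set E} (hs : IsCompact s)
    (ht : IsCompact t) : IsCompact (convexJoin ℝ s t) := by
  have h : convexJoin ℝ s t = (fun p : (E × E) × ℝ => (1 - p.2) • p.1.1 + p.2 • p.1.2) ''
      ((s ×ˢ t) ×ˢ Set.Icc (0 : ℝ) 1) := by
    ext x
    simp only [mem_convexJoin, segment_eq_image, Set.mem_image, Set.mem_prod, Prod.exists]
    constructor
    · rintro ⟨a, ha, b, hb, θ, hθ, rfl⟩
      exact ⟨a, b, θ, ⟨⟨ha, hb⟩, hθ⟩, rfl⟩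
    · rintro ⟨a, b, θ, ⟨⟨ha, hb⟩, hθ⟩, rfl⟩
      exact ⟨a, ha, b, hb, θ, hθ, rfl⟩
  rw [h]
  exact ((hs.prod ht).prod isCompact_Icc).image (by fun_prop)

theorem aux_hull {E : Type*} [AddCommGroup E] [Module ℝ E] [TopologicalSpace E]
    [IsTopologicalAddGroup E] [ContinuousSMul ℝ E] (D : ℕ → Set E) (hc : ∀ n, Convex ℝ (D n))
    (hk : ∀ n, IsCompact (D n)) (N : ℕ) : IsCompact (convexHull ℝ (⋃ n < N, D n)) := by
  induction N with
  | zero => simp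
  | succ N ih =>
    rw [Set.biUnion_lt_succ]
    rcases Set.eq_empty_or_nonempty (⋃ n < N, D n) with h1 | h1
    · rw [h1, Set.empty_union, (hc N).convexHull_eq]
      exact hk N
    rcases Set.eq_empty_or_nonempty (D N) with h2 | h2
    · rw [h2, Set.union_empty]
      exact ih
    rw [convexHull_union h1 h2, (hc N).convexHull_eq]
    exact aux_convexJoin ih (hk N)

theorem aux_sep {X : Type*} [NormedAddCommGroup X] [NormedSpace ℝ X]
    (K : Set (WeakDual ℝ X)) (hK : IsCompact K) (hc : Convex ℝ K) (η : WeakDual ℝ X)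
    (hη : η ∉ K) : ∃ x : X, ∀ ξ ∈ K, ξ x < η x := by
  have : LocallyConvexSpace ℝ (WeakDual ℝ X) :=
    inferInstanceAs (LocallyConvexSpace ℝ (WeakBilin (topDualPairing ℝ X)))
  obtain ⟨f, u, h1, h2⟩ := geometric_hahn_banach_closed_point hc hK.isClosed hη
  obtain ⟨x, hx⟩ := LinearMap.dualEmbedding_surjective (topDualPairing ℝ X) f
  have e : ∀ ξ : WeakDual ℝ X, f ξ = ξ x := fun ξ => by rw [← hx]; rfl
  refine ⟨x, fun ξ hξ => ?_⟩
  rw [← e, ← e]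
  exact (h1 ξ hξ).trans h2

theorem aux_wtop {X : Type*} [NormedAddCommGroup X] [NormedSpace ℝ X]
    (A : Set (X →L[ℝ] ℝ)) :
    wstarClosure A = (closure (X := WeakDual ℝ X) A : Set (WeakDual ℝ X)) := rfl

theorem aux_D {X : Type*} [NormedAddCommGroup X] [NormedSpace ℝ X]
    (A : Set (WeakDual ℝ X)) (R : ℝ)
    (hA : A ⊆ WeakDual.toStrongDual ⁻¹' (Metric.closedBall 0 R)) :
    IsCompact (closure (convexHull ℝ A)) ∧ Convex ℝ (closure (convexHull ℝ A)) := by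
  refine ⟨?_, (convex_convexHull ℝ A).closure⟩
  have hcv : Convex ℝ ((WeakDual.toStrongDual : WeakDual ℝ X ≃ₗ[ℝ] _) ⁻¹'
      (Metric.closedBall (0 : StrongDual ℝ X) R)) :=
    (convex_closedBall (0 : StrongDual ℝ X) R).linear_preimage
      (WeakDual.toStrongDual : WeakDual ℝ X ≃ₗ[ℝ] _).toLinearMap
  exact (WeakDual.isCompact_closedBall (0 : StrongDual ℝ X) R).of_isClosed_subset isClosed_closure
    (closure_minimal (convexHull_min hA hcv) (WeakDual.isClosed_closedBall 0 R))

/-- Key lemma: a point outside the hull of a cover is separated sequentially. -/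
theorem aux_key {X : Type*} [NormedAddCommGroup X] [NormedSpace ℝ X]
    (As : ℕ → Set (X →L[ℝ] ℝ)) (η : X →L[ℝ] ℝ)
    (hη : η ∉ convexHull ℝ (⋃ n, wstarClosure (convexHull ℝ (As n)))) :
    ∃ x : ℕ → X, ∀ ξ ∈ ⋃ n, As n, ∀ᶠ n in atTop, ξ (x n) < η (x n) := by
  let B : ℕ → ℕ → Set (WeakDual ℝ X) := fun N n =>
    {ξ : WeakDual ℝ X | WeakDual.toStrongDual ξ ∈ As n ∧
      WeakDual.toStrongDual ξ ∈ Metric.closedBall (0 : StrongDual ℝ X) N}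
  have hB : ∀ N n, IsCompact (closure (convexHull ℝ (B N n))) ∧
      Convex ℝ (closure (convexHull ℝ (B N n))) :=
    fun N n => aux_D _ N (fun ξ hξ => hξ.2)
  let K : ℕ → Set (WeakDual ℝ X) := fun N =>
    convexHull ℝ (⋃ n < N, closure (convexHull ℝ (B N n)))
  have hK : ∀ N, IsCompact (K N) := fun N =>
    aux_hull _ (fun n => (hB N n).2) (fun n => (hB N n).1) N
  have hsub : ∀ N, K N ⊆ (convexHull ℝ (⋃ n, closure (X := WeakDual ℝ X)
      (convexHull ℝ (show Set (WeakDual ℝ X) from As n)))) := by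
    intro N
    apply convexHull_mono
    apply Set.iUnion₂_subset
    intro n hn
    refine Set.Subset.trans ?_ (Set.subset_iUnion _ n)
    exact closure_mono (convexHull_mono fun ξ hξ => hξ.1)
  have hnot : ∀ N, (StrongDual.toWeakDual η) ∉ K N := fun N h => hη (hsub N h)
  choose x hx using fun N => aux_sep (K N) (hK N) (convex_convexHull ℝ _) _ (hnot N)
  refine ⟨x, fun ξ hξ => ?_⟩
  obtain ⟨m, hm⟩ := Set.mem_iUnion.1 hξ
  obtain ⟨M, hM⟩ := exists_nat_ge ‖ξ‖
  filter_upwards [eventually_ge_atTop (max (m + 1) M)] with N hN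
  refine hx N (StrongDual.toWeakDual ξ) ?_
  have hmN : m < N := lt_of_lt_of_le (Nat.lt_succ_self m) ((le_max_left _ _).trans hN)
  have hMN : (M : ℝ) ≤ N := by exact_mod_cast (le_max_right _ _).trans hN
  apply subset_convexHull
  refine Set.mem_iUnion₂.2 ⟨m, hmN, subset_closure (subset_convexHull _ _ ⟨hm, ?_⟩)⟩
  rw [mem_closedBall_zero_iff]
  exact hM.trans hMN

theorem aux_closure_subset {X : Type*} [NormedAddCommGroup X] [NormedSpace ℝ X]
    (A : Set (X →L[ℝ] ℝ)) : closure A ⊆ Ienv A := by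
  refine Set.subset_iInter₂ fun As hAs => closure_mono ?_
  refine Set.Subset.trans ?_ (subset_convexHull ℝ _)
  rw [hAs]
  refine Set.iUnion_mono fun n => ?_
  rw [aux_wtop]
  exact (subset_convexHull ℝ (As n)).trans (subset_closure (X := WeakDual ℝ X))

theorem aux_B1 {X : Type*} [NormedAddCommGroup X] [NormedSpace ℝ X]
    (F : (X →L[ℝ] ℝ) →L[ℝ] ℝ) (x : ℕ → X)
    (hx : ∀ ξ : X →L[ℝ] ℝ, Tendsto (fun n => ξ (x n)) atTop (𝓝 (F ξ)))
    (η : X →L[ℝ] ℝ) (hη : η ∈ Ienv {ξ : X →L[ℝ] ℝ | F ξ = 0}) : F η = 0 := by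
  by_contra hne
  have hpos : 0 < |F η| / 2 := by positivity
  set ε := |F η| / 2 with hε
  let As : ℕ → Set (X →L[ℝ] ℝ) := fun n => {ξ | F ξ = 0 ∧ ∀ k ≥ n, |ξ (x k)| ≤ ε}
  let Bs : ℕ → Set (WeakDual ℝ X) := fun n => {ξ | ∀ k ≥ n, |ξ (x k)| ≤ ε}
  have hcov : {ξ : X →L[ℝ] ℝ | F ξ = 0} = ⋃ n, As n := by
    ext ξ
    simp only [Set.mem_iUnion]
    constructor
    · intro h
      have h' : F ξ = 0 := h
      have := (hx ξ).abs
      rw [h', abs_zero] at this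
      obtain ⟨n, hn⟩ := eventually_atTop.1 (this.eventually (Iic_mem_nhds hpos))
      exact ⟨n, h', hn⟩
    · rintro ⟨n, hn⟩
      exact hn.1
  have hcl : ∀ n, IsClosed (Bs n) := by
    intro n
    have : Bs n = ⋂ k, ⋂ (_ : k ≥ n), {ξ : WeakDual ℝ X | |ξ (x k)| ≤ ε} := by
      ext ξ; simp [Bs]
    rw [this]
    exact isClosed_iInter fun k => isClosed_iInter fun _ =>
      isClosed_le (WeakDual.eval_continuous (x k)).abs continuous_const
  have hcv : ∀ n, Convex ℝ (Bs n) := by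
    intro n ξ hξ ζ hζ a b ha hb hab k hk
    have e : (a • ξ + b • ζ) (x k) = a * ξ (x k) + b * ζ (x k) := rfl
    rw [e]
    have h1 := abs_le.1 (hξ k hk)
    have h2 := abs_le.1 (hζ k hk)
    rw [abs_le]
    constructor <;> nlinarith
  have hS : convexHull ℝ (⋃ n, wstarClosure (convexHull ℝ (As n))) ⊆
      {ξ : X →L[ℝ] ℝ | |F ξ| ≤ ε} := by
    apply convexHull_min
    · apply Set.iUnion_subset
      intro n
      have h1 : wstarClosure (convexHull ℝ (As n)) ⊆ Bs n := by
        rw [aux_wtop]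
        exact closure_minimal (convexHull_min (fun ξ hξ => hξ.2) (hcv n)) (hcl n)
      intro ξ hξ
      have h2 : ∀ k ≥ n, |ξ (x k)| ≤ ε := h1 hξ
      exact le_of_tendsto (hx ξ).abs (eventually_atTop.2 ⟨n, h2⟩)
    · intro ξ hξ ζ hζ a b ha hb hab
      have h1 := abs_le.1 (show |F ξ| ≤ ε from hξ)
      have h2 := abs_le.1 (show |F ζ| ≤ ε from hζ)
      show |F (a • ξ + b • ζ)| ≤ ε
      rw [map_add, map_smul, map_smul, smul_eq_mul, smul_eq_mul, abs_le]
      constructor <;> nlinarith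
  have h1 := Set.mem_iInter₂.1 hη As hcov
  have h2 : |F η| ≤ ε := closure_minimal hS (isClosed_le F.continuous.abs continuous_const) h1
  linarith

theorem aux_fwd {X : Type*} [NormedAddCommGroup X] [NormedSpace ℝ X]
    (φ : (X →L[ℝ] ℝ) →ₗ[ℝ] ℝ)
    (hI : Ienv (LinearMap.ker φ : Set (X →L[ℝ] ℝ)) = (LinearMap.ker φ : Set (X →L[ℝ] ℝ))) :
    ∃ F ∈ B1 X, ∀ ξ : X →L[ℝ] ℝ, φ ξ = F ξ := by
  have hcl : IsClosed (LinearMap.ker φ : Set (X →L[ℝ] ℝ)) := by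
    apply isClosed_of_closure_subset
    exact (aux_closure_subset _).trans hI.subset
  have hcont : Continuous φ := φ.continuous_of_isClosed_ker hcl
  refine ⟨⟨φ, hcont⟩, ?_, fun ξ => rfl⟩
  by_cases h0 : φ = 0
  · refine ⟨fun _ => 0, fun ξ => ?_⟩
    subst h0
    simp
  obtain ⟨η, hη⟩ : ∃ η, φ η ≠ 0 := by
    by_contra! h
    exact h0 (LinearMap.ext h)
  have hnot : η ∉ Ienv (LinearMap.ker φ : Set (X →L[ℝ] ℝ)) := by
    rw [hI]; exact hη
  simp only [Ienv, Set.mem_iInter, not_forall] at hnot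
  obtain ⟨As, hAs, hn⟩ := hnot
  obtain ⟨x, hx⟩ := aux_key As η (fun h => hn (subset_closure h))
  rw [← hAs] at hx
  have hpos : ∀ᶠ n in atTop, 0 < η (x n) := by
    simpa using hx 0 (LinearMap.ker φ).zero_mem
  have hz : ∀ ξ ∈ LinearMap.ker φ,
      Tendsto (fun n => ξ (x n) / η (x n)) atTop (𝓝 0) := by
    intro ξ hξ
    rw [Metric.tendsto_nhds]
    intro ε hε
    filter_upwards [hpos, hx (ε⁻¹ • ξ) ((LinearMap.ker φ).smul_mem _ hξ),
      hx ((-ε⁻¹) • ξ) ((LinearMap.ker φ).smul_mem _ hξ)] with n h1 h2 h3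
    have h2 : ε⁻¹ * ξ (x n) < η (x n) := h2
    have h3 : -ε⁻¹ * ξ (x n) < η (x n) := h3
    rw [dist_zero_right, Real.norm_eq_abs, abs_div, abs_of_pos h1, div_lt_iff₀ h1, abs_lt]
    have h4 := mul_lt_mul_of_pos_left h2 hε
    have h5 := mul_lt_mul_of_pos_left h3 hε
    have e1 : ε * (ε⁻¹ * ξ (x n)) = ξ (x n) := by field_simp
    have e2 : ε * (-ε⁻¹ * ξ (x n)) = - ξ (x n) := by field_simp
    constructor <;> linarith
  refine ⟨fun n => (φ η / η (x n)) • x n, fun ξ => ?_⟩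
  show Tendsto _ _ (𝓝 (φ ξ))
  have hk : ξ - (φ ξ / φ η) • η ∈ LinearMap.ker φ := by
    rw [LinearMap.mem_ker, map_sub, map_smul, smul_eq_mul]
    field_simp
    ring
  have ht := ((hz _ hk).const_mul (φ η)).add_const (φ ξ)
  rw [mul_zero, zero_add] at ht
  refine ht.congr' ?_
  filter_upwards [hpos] with n hn
  have e : (ξ - (φ ξ / φ η) • η) (x n) = ξ (x n) - φ ξ / φ η * η (x n) := rfl
  rw [e, map_smul, smul_eq_mul]
  field_simp
  ring

theorem stmt4 {X : Type*} [NormedAddCommGroup X] [NormedSpace ℝ X] [CompleteSpace X]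
    (τ : TopologicalSpace (X →L[ℝ] ℝ))
    (hadd : @IsTopologicalAddGroup (X →L[ℝ] ℝ) τ _)
    (hsmul : @ContinuousSMul ℝ (X →L[ℝ] ℝ) _ _ τ)
    (hlc : @LocallyConvexSpace ℝ (X →L[ℝ] ℝ) _ _ _ _ τ)
    (hτ : ∀ A : Set (X →L[ℝ] ℝ), Ienv A = @closure _ τ (convexHull ℝ A))
    (φ : (X →L[ℝ] ℝ) →ₗ[ℝ] ℝ) :
    @Continuous _ _ τ _ φ ↔ ∃ F ∈ B1 X, ∀ ξ : X →L[ℝ] ℝ, φ ξ = F ξ := by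
  have hker : Convex ℝ (LinearMap.ker φ : Set (X →L[ℝ] ℝ)) := (LinearMap.ker φ).convex
  have hI := hτ (LinearMap.ker φ : Set (X →L[ℝ] ℝ))
  rw [hker.convexHull_eq] at hI
  constructor
  · intro hφ
    have hclτ : @IsClosed _ τ (LinearMap.ker φ : Set (X →L[ℝ] ℝ)) :=
      @IsClosed.preimage _ _ τ _ φ hφ {0} isClosed_singleton
    rw [@IsClosed.closure_eq _ τ _ hclτ] at hI
    exact aux_fwd φ hI
  · rintro ⟨F, ⟨x, hx⟩, hF⟩
    apply @LinearMap.continuous_of_isClosed_ker ℝ _ _ _ _ τ hadd hsmul φ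
    apply @isClosed_of_closure_subset _ τ
    rw [← hI]
    intro η hη
    have e : (LinearMap.ker φ : Set (X →L[ℝ] ℝ)) = {ξ : X →L[ℝ] ℝ | F ξ = 0} := by
      ext ξ
      show φ ξ = 0 ↔ F ξ = 0
      rw [hF]
    rw [e] at hη
    show φ η = 0
    rw [hF]
    exact aux_B1 F x hx η hη
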